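/- Let K ⊆ ℝ^d be compact, k a continuous integrally strictly positive definite kernel on K, and Q' ∈ P(K). Define v(x; Q) = ∫ k(x,x') d(Q' − Q)(x') and v̄(x; Q) = v(x; Q) − ∫ v dQ. Call Q ∈ P(K) a fixed point if v̄(x; Q) = 0 for Q-almost every x. Then: (a) if Q is a fixed point and the support of Q' is contained in the support of Q, then Q = Q'; in particular the fixed-point set is contained in {Q'} ∪ {Q ∈ P(K) : supp Q' ⊄ supp Q}. (b) If (Q_t)_{t≥0} is a trajectory of the dynamics dQ_t/dt = v̄(·; Q_t) Q_t (in the weak sense), then every weak limit point of (Q_t) as t → ∞ is a fixed point. -/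

import Mathlib

open MeasureTheory Real Filter
open scoped Topology

/-- A kernel `k` is integrally strictly positive definite on `K` if
`∬ k d(μ−ν) d(μ−ν) = 0` implies `μ = ν` for finite measures `μ, ν` supported in `K`. -/
def IsISPD {E : Type*} [MeasurableSpace E] (k : E → E → ℝ) (K : Set E) : Prop :=
  ∀ μ ν : Measure E, IsFiniteMeasure μ → IsFiniteMeasure ν → μ Kᶜ = 0 → ν Kᶜ = 0 →
    (∫ x, ∫ y, k x y ∂μ ∂μ) - 2 * (∫ x, ∫ y, k x y ∂ν ∂μ) + (∫ x, ∫ y, k x y ∂ν ∂ν) = 0 →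
    μ = ν

/-- The (topological) support of a measure: points all of whose open neighborhoods have
positive measure. -/
def msupport {E : Type*} [MeasurableSpace E] [TopologicalSpace E] (Q : Measure E) :
    Set E :=
  {x | ∀ U : Set E, IsOpen U → x ∈ U → 0 < Q U}

/-- The velocity potential `v(x;Q) = ∫ k(x,x') d(Q' − Q)(x')`. -/
noncomputable def vField {E : Type*} [MeasurableSpace E] (k : E → E → ℝ)
    (Q' Q : Measure E) (x : E) : ℝ :=
  (∫ y, k x y ∂Q') - ∫ y, k x y ∂Q

/-- The centered velocity `v̄(x;Q) = v(x;Q) − ∫ v(·;Q) dQ`. -/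
noncomputable def vBar {E : Type*} [MeasurableSpace E] (k : E → E → ℝ)
    (Q' Q : Measure E) (x : E) : ℝ :=
  vField k Q' Q x - ∫ y, vField k Q' Q y ∂Q

/-- `L` is a weak limit point of the trajectory `t ↦ Q t` as `t → ∞`. -/
def IsWeakLimitPt {E : Type*} [MeasurableSpace E] [TopologicalSpace E]
    (Q : ℝ → Measure E) (L : Measure E) : Prop :=
  ∃ u : ℕ → ℝ, Tendsto u atTop atTop ∧
    ∀ f : BoundedContinuousFunction E ℝ,
      Tendsto (fun m => ∫ x, f x ∂(Q (u m))) atTop (𝓝 (∫ x, f x ∂L))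

open scoped BoundedContinuousFunction

section core

variable {E : Type*} [MetricSpace E] [SecondCountableTopology E] [MeasurableSpace E] [BorelSpace E]

/-- Integral of a bounded continuous function. -/
noncomputable def JJ (Q : ProbabilityMeasure E) (f : E →ᵇ ℝ) : ℝ := ∫ x, f x ∂(Q : Measure E)

lemma JJ_add (Q : ProbabilityMeasure E) (f g : E →ᵇ ℝ) : JJ Q (f + g) = JJ Q f + JJ Q g :=
  integral_add (f.integrable _) (g.integrable _)

lemma JJ_sub (Q : ProbabilityMeasure E) (f g : E →ᵇ ℝ) : JJ Q (f - g) = JJ Q f - JJ Q g :=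
  integral_sub (f.integrable _) (g.integrable _)

lemma JJ_const (Q : ProbabilityMeasure E) (c : ℝ) :
    JJ Q (BoundedContinuousFunction.const E c) = c := by
  simp [JJ]

lemma JJ_const_mul (Q : ProbabilityMeasure E) (c : ℝ) (f : E →ᵇ ℝ) :
    JJ Q (BoundedContinuousFunction.const E c * f) = c * JJ Q f := by
  simp [JJ, integral_const_mul]

lemma JJ_abs_le (Q : ProbabilityMeasure E) (f : E →ᵇ ℝ) : |JJ Q f| ≤ ‖f‖ :=
  f.norm_integral_le_norm (μ := (Q : Measure E))

/-- Section of the kernel. -/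
noncomputable def secK (k : (E × E) →ᵇ ℝ) (x : E) : E →ᵇ ℝ :=
  k.compContinuous ⟨fun y => (x, y), by fun_prop⟩

lemma secK_norm (k : (E × E) →ᵇ ℝ) (x : E) : ‖secK k x‖ ≤ ‖k‖ :=
  (BoundedContinuousFunction.norm_le (norm_nonneg _)).2 fun y => k.norm_coe_le_norm (x, y)

/-- Mean embedding. -/
noncomputable def gK (k : (E × E) →ᵇ ℝ) (Q : ProbabilityMeasure E) : E →ᵇ ℝ :=
  BoundedContinuousFunction.ofNormedAddCommGroup (fun x => ∫ y, k (x, y) ∂(Q : Measure E))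
    (by
      refine continuous_of_dominated (bound := fun _ => ‖k‖) ?_ ?_ (integrable_const _) ?_
      · intro x
        exact (by fun_prop : Continuous fun y => k (x, y)).aestronglyMeasurable
      · intro x
        exact Eventually.of_forall fun y => k.norm_coe_le_norm _
      · exact Eventually.of_forall fun y => by fun_prop)
    ‖k‖ (fun x => JJ_abs_le Q (secK k x) |>.trans (secK_norm k x))

lemma gK_apply (k : (E × E) →ᵇ ℝ) (Q : ProbabilityMeasure E) (x : E) :
    gK k Q x = JJ Q (secK k x) := rfl

lemma gK_norm (k : (E × E) →ᵇ ℝ) (Q : ProbabilityMeasure E) : ‖gK k Q‖ ≤ ‖k‖ :=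
  (BoundedContinuousFunction.norm_le (norm_nonneg _)).2 fun x =>
    (JJ_abs_le Q (secK k x)).trans (secK_norm k x)

lemma JJ_gK_symm (k : (E × E) →ᵇ ℝ) (hk : ∀ x y, k (x, y) = k (y, x))
    (P Q : ProbabilityMeasure E) : JJ P (gK k Q) = JJ Q (gK k P) := by
  have h := integral_integral_swap (μ := (P : Measure E)) (ν := (Q : Measure E))
    (f := fun x y => k (x, y)) (k.integrable _)
  change ∫ x, ∫ y, k (x, y) ∂(Q : Measure E) ∂(P : Measure E) = _
  rw [h]
  simp_rw [fun x y => hk x y]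
  rfl

/-- velocity -/
noncomputable def vK (k : (E × E) →ᵇ ℝ) (Q' Q : ProbabilityMeasure E) : E →ᵇ ℝ :=
  gK k Q' - gK k Q

/-- centered velocity -/
noncomputable def wK (k : (E × E) →ᵇ ℝ) (Q' Q : ProbabilityMeasure E) : E →ᵇ ℝ :=
  vK k Q' Q - BoundedContinuousFunction.const E (JJ Q (vK k Q' Q))

/-- variance -/
noncomputable def VK (k : (E × E) →ᵇ ℝ) (Q' Q : ProbabilityMeasure E) : ℝ :=
  JJ Q (wK k Q' Q * wK k Q' Q)

/-- energy -/
noncomputable def EK (k : (E × E) →ᵇ ℝ) (Q' Q : ProbabilityMeasure E) : ℝ :=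
  (1 / 2) * JJ Q (gK k Q) - JJ Q (gK k Q')

lemma wK_apply (k : (E × E) →ᵇ ℝ) (Q' Q : ProbabilityMeasure E) (x : E) :
    wK k Q' Q x = vBar (fun x y => k (x, y)) Q' Q x := rfl

lemma const_norm_le (c : ℝ) : ‖BoundedContinuousFunction.const E c‖ ≤ |c| :=
  BoundedContinuousFunction.norm_const_le c

lemma vK_norm (k : (E × E) →ᵇ ℝ) (Q' Q : ProbabilityMeasure E) : ‖vK k Q' Q‖ ≤ 2 * ‖k‖ := by
  have := norm_sub_le (gK k Q') (gK k Q)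
  have := gK_norm k Q
  have := gK_norm k Q'
  unfold vK; linarith

lemma wK_norm (k : (E × E) →ᵇ ℝ) (Q' Q : ProbabilityMeasure E) : ‖wK k Q' Q‖ ≤ 4 * ‖k‖ := by
  have h1 := norm_sub_le (vK k Q' Q) (BoundedContinuousFunction.const E (JJ Q (vK k Q' Q)))
  have := vK_norm k Q' Q
  have := JJ_abs_le Q (vK k Q' Q)
  have := const_norm_le (E := E) (JJ Q (vK k Q' Q))
  unfold wK; linarith

lemma VK_nonneg (k : (E × E) →ᵇ ℝ) (Q' Q : ProbabilityMeasure E) : 0 ≤ VK k Q' Q :=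
  integral_nonneg fun x => mul_self_nonneg _

lemma JJ_wK (k : (E × E) →ᵇ ℝ) (Q' Q : ProbabilityMeasure E) : JJ Q (wK k Q' Q) = 0 := by
  rw [wK, JJ_sub, JJ_const, sub_self]

lemma VK_eq (k : (E × E) →ᵇ ℝ) (Q' Q : ProbabilityMeasure E) :
    VK k Q' Q = JJ Q (vK k Q' Q * wK k Q' Q) := by
  have : vK k Q' Q * wK k Q' Q = wK k Q' Q * wK k Q' Q +
      BoundedContinuousFunction.const E (JJ Q (vK k Q' Q)) * wK k Q' Q := by
    rw [← add_mul]; congr 1; simp [wK]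
  rw [this, JJ_add, JJ_const_mul, JJ_wK, mul_zero, add_zero, VK]

lemma VK_eq' (k : (E × E) →ᵇ ℝ) (Q' Q : ProbabilityMeasure E) :
    VK k Q' Q = JJ Q (vK k Q' Q * vK k Q' Q) - (JJ Q (vK k Q' Q)) ^ 2 := by
  have : vK k Q' Q * wK k Q' Q = vK k Q' Q * vK k Q' Q -
      BoundedContinuousFunction.const E (JJ Q (vK k Q' Q)) * vK k Q' Q := by
    rw [← sub_mul, mul_comm]; rfl
  rw [VK_eq, this, JJ_sub, JJ_const_mul, sq]

section traj
variable (k : (E × E) →ᵇ ℝ) (Q' : ProbabilityMeasure E) (P : ℝ → ProbabilityMeasure E)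
  (hP : ∀ (f : E →ᵇ ℝ) (t : ℝ), 0 ≤ t →
    HasDerivWithinAt (fun s => JJ (P s) f) (JJ (P t) (f * wK k Q' (P t))) (Set.Ici 0) t)
include hP

lemma JJ_lip (f : E →ᵇ ℝ) {s t : ℝ} (hs : 0 ≤ s) (ht : 0 ≤ t) :
    |JJ (P t) f - JJ (P s) f| ≤ ‖f‖ * (4 * ‖k‖) * |t - s| := by
  refine Convex.norm_image_sub_le_of_norm_hasDerivWithin_le (s := Set.Ici (0:ℝ))
    (f := fun s => JJ (P s) f) (fun x hx => hP f x hx) ?_ (convex_Ici 0) hs ht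
  intro x hx
  refine (JJ_abs_le _ _).trans ((norm_mul_le _ _).trans ?_)
  gcongr
  exact wK_norm _ _ _

lemma gK_lip {s t : ℝ} (hs : 0 ≤ s) (ht : 0 ≤ t) :
    ‖gK k (P t) - gK k (P s)‖ ≤ ‖k‖ * (4 * ‖k‖) * |t - s| := by
  refine (BoundedContinuousFunction.norm_le (by positivity)).2 fun x => ?_
  refine (JJ_lip k Q' P hP (secK k x) hs ht).trans ?_
  gcongr
  exact secK_norm k x

lemma wK_lip {s t : ℝ} (hs : 0 ≤ s) (ht : 0 ≤ t) :
    ‖wK k Q' (P t) - wK k Q' (P s)‖ ≤ 16 * ‖k‖ ^ 2 * |t - s| := by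
  have h1 := gK_lip k Q' P hP hs ht
  have hv : vK k Q' (P t) - vK k Q' (P s) = - (gK k (P t) - gK k (P s)) := by
    simp only [vK]; abel
  have h2 : ‖vK k Q' (P t) - vK k Q' (P s)‖ ≤ 4 * ‖k‖ ^ 2 * |t - s| := by
    rw [hv, norm_neg]; refine h1.trans (le_of_eq ?_); ring
  set c := JJ (P t) (vK k Q' (P t)) - JJ (P s) (vK k Q' (P s)) with hc
  have hw : wK k Q' (P t) - wK k Q' (P s) = (vK k Q' (P t) - vK k Q' (P s)) -
      BoundedContinuousFunction.const E c := by
    ext x; simp [wK, hc]; ring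
  have hc1 : c = JJ (P t) (vK k Q' (P t) - vK k Q' (P s)) +
      (JJ (P t) (vK k Q' (P s)) - JJ (P s) (vK k Q' (P s))) := by
    rw [JJ_sub, hc]; ring
  have hc2 : |c| ≤ 12 * ‖k‖ ^ 2 * |t - s| := by
    rw [hc1]
    have a1 := abs_add_le (JJ (P t) (vK k Q' (P t) - vK k Q' (P s)))
      (JJ (P t) (vK k Q' (P s)) - JJ (P s) (vK k Q' (P s)))
    have a2 := JJ_abs_le (P t) (vK k Q' (P t) - vK k Q' (P s))
    have a3 := JJ_lip k Q' P hP (vK k Q' (P s)) hs ht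
    have a4 : ‖vK k Q' (P s)‖ * (4 * ‖k‖) * |t - s| ≤ (2 * ‖k‖) * (4 * ‖k‖) * |t - s| := by
      gcongr; exact vK_norm _ _ _
    linarith
  rw [hw]
  have := norm_sub_le (vK k Q' (P t) - vK k Q' (P s)) (BoundedContinuousFunction.const E c)
  have := const_norm_le (E := E) c
  linarith

lemma descent (hk : ∀ x y, k (x, y) = k (y, x)) {s t : ℝ} (hs : 0 ≤ s) (hst : s ≤ t) :
    EK k Q' (P t) - EK k Q' (P s) ≤ - ((t - s) * VK k Q' (P s)) + 72 * ‖k‖ ^ 3 * (t - s) ^ 2 := by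
  have ht : 0 ≤ t := hs.trans hst
  have e1 : EK k Q' (P t) - EK k Q' (P s) =
      (1 / 2) * (JJ (P t) (gK k (P t) - gK k (P s)) - JJ (P s) (gK k (P t) - gK k (P s)))
      - (JJ (P t) (vK k Q' (P s)) - JJ (P s) (vK k Q' (P s))) := by
    simp only [EK, vK, JJ_sub]
    rw [JJ_gK_symm k hk (P s) (P t)]
    ring
  have b1 := JJ_lip k Q' P hP (gK k (P t) - gK k (P s)) hs ht
  have b2 : ‖gK k (P t) - gK k (P s)‖ * (4 * ‖k‖) * |t - s| ≤
      (‖k‖ * (4 * ‖k‖) * |t - s|) * (4 * ‖k‖) * |t - s| := by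
    gcongr; exact gK_lip k Q' P hP hs ht
  have b3 := (le_abs_self _).trans (b1.trans b2)
  have hd : |t - s| = t - s := abs_of_nonneg (by linarith)
  have b4 : |(JJ (P t) (vK k Q' (P s)) - t * VK k Q' (P s))
      - (JJ (P s) (vK k Q' (P s)) - s * VK k Q' (P s))| ≤ (64 * ‖k‖ ^ 3 * (t - s)) * |t - s| := by
    refine Convex.norm_image_sub_le_of_norm_hasDerivWithin_le (s := Set.Icc s t)
      (f := fun r => JJ (P r) (vK k Q' (P s)) - r * VK k Q' (P s))
      (f' := fun r => JJ (P r) (vK k Q' (P s) * wK k Q' (P r)) - 1 * VK k Q' (P s))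
      (fun r hr => ?_) ?_ (convex_Icc s t) (Set.left_mem_Icc.2 hst) (Set.right_mem_Icc.2 hst)
    · refine HasDerivWithinAt.sub ?_ ?_
      · exact (hP (vK k Q' (P s)) r (hs.trans hr.1)).mono fun z hz => hs.trans hz.1
      · exact ((hasDerivAt_id r).mul_const _).hasDerivWithinAt
    · intro r hr
      have hr0 := hs.trans hr.1
      rw [one_mul, VK_eq, Real.norm_eq_abs]
      have c0 : JJ (P r) (vK k Q' (P s) * wK k Q' (P r)) - JJ (P s) (vK k Q' (P s) * wK k Q' (P s))
        = JJ (P r) (vK k Q' (P s) * (wK k Q' (P r) - wK k Q' (P s))) +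
          (JJ (P r) (vK k Q' (P s) * wK k Q' (P s)) - JJ (P s) (vK k Q' (P s) * wK k Q' (P s))) := by
        rw [mul_sub, JJ_sub]; ring
      rw [c0]
      refine (abs_add_le _ _).trans ?_
      have hv := vK_norm k Q' (P s)
      have hw := wK_norm k Q' (P s)
      have c1 : |JJ (P r) (vK k Q' (P s) * (wK k Q' (P r) - wK k Q' (P s)))| ≤
          (2 * ‖k‖) * (16 * ‖k‖ ^ 2 * |r - s|) := by
        refine (JJ_abs_le _ _).trans ((norm_mul_le _ _).trans ?_)
        gcongr
        exact wK_lip k Q' P hP hs hr0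
      have c2 := JJ_lip k Q' P hP (vK k Q' (P s) * wK k Q' (P s)) hs hr0
      have c3 : ‖vK k Q' (P s) * wK k Q' (P s)‖ * (4 * ‖k‖) * |r - s| ≤
          ((2 * ‖k‖) * (4 * ‖k‖)) * (4 * ‖k‖) * |r - s| := by
        gcongr
        refine (norm_mul_le _ _).trans ?_
        gcongr
      have c4 : |r - s| ≤ t - s := by
        rw [abs_of_nonneg (by linarith [hr.1])]; linarith [hr.2]
      have c5 : 64 * ‖k‖ ^ 3 * |r - s| ≤ 64 * ‖k‖ ^ 3 * (t - s) := by gcongr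
      nlinarith [c1, c2, c3, c5]
  have b5 := neg_abs_le ((JJ (P t) (vK k Q' (P s)) - t * VK k Q' (P s))
      - (JJ (P s) (vK k Q' (P s)) - s * VK k Q' (P s)))
  rw [hd] at b3 b4
  rw [e1]
  nlinarith

lemma EK_anti (hk : ∀ x y, k (x, y) = k (y, x)) {s t : ℝ} (hs : 0 ≤ s) (hst : s ≤ t) :
    EK k Q' (P t) ≤ EK k Q' (P s) := by
  set C := 72 * ‖k‖ ^ 3
  have key : ∀ δ : ℝ, 0 ≤ δ → ∀ n : ℕ,
      EK k Q' (P (s + n * δ)) - EK k Q' (P s) ≤ n * (C * δ ^ 2) := by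
    intro δ hδ n
    induction n with
    | zero => simp
    | succ n ih =>
      have h := descent k Q' P hP hk (s := s + n * δ) (t := s + (n + 1 : ℕ) * δ)
        (by positivity) (by push_cast; nlinarith)
      have h2 : (s + (n + 1 : ℕ) * δ) - (s + n * δ) = δ := by push_cast; ring
      rw [h2] at h
      have h3 : 0 ≤ δ * VK k Q' (P (s + n * δ)) := mul_nonneg hδ (VK_nonneg _ _ _)
      have h4 : ((n + 1 : ℕ) : ℝ) * (C * δ ^ 2) = n * (C * δ ^ 2) + C * δ ^ 2 := by
        push_cast; ring
      rw [h4]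
      linarith
  have key2 : ∀ n : ℕ, EK k Q' (P t) - EK k Q' (P s) ≤ C * (t - s) ^ 2 * (1 / ((n : ℝ) + 1)) := by
    intro n
    have hn : (0 : ℝ) < n + 1 := by positivity
    have h := key ((t - s) / (n + 1)) (div_nonneg (by linarith) hn.le) (n + 1)
    have e1 : s + ((n + 1 : ℕ) : ℝ) * ((t - s) / (n + 1)) = t := by
      push_cast; field_simp; ring
    rw [e1] at h
    refine h.trans (le_of_eq ?_)
    push_cast; field_simp
  have lim : Tendsto (fun n : ℕ => C * (t - s) ^ 2 * (1 / ((n : ℝ) + 1))) atTop (𝓝 (C * (t - s) ^ 2 * 0)) :=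
    tendsto_one_div_add_atTop_nhds_zero_nat.const_mul _
  have := ge_of_tendsto' lim key2
  linarith

lemma VK_limit (hk : ∀ x y, k (x, y) = k (y, x)) (L : ProbabilityMeasure E) (u : ℕ → ℝ)
    (hu : Tendsto u atTop atTop)
    (hE : Tendsto (fun m => EK k Q' (P (u m))) atTop (𝓝 (EK k Q' L)))
    (hV : Tendsto (fun m => VK k Q' (P (u m))) atTop (𝓝 (VK k Q' L))) : VK k Q' L = 0 := by
  by_contra hne
  have hpos : 0 < VK k Q' L := lt_of_le_of_ne (VK_nonneg _ _ _) (Ne.symm hne)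
  set c := VK k Q' L / 2 with hc
  have hcpos : 0 < c := by positivity
  set C := 72 * ‖k‖ ^ 3 + 1 with hC
  have hCpos : 0 < C := by positivity
  set δ := c / (2 * C) with hδ
  have hδpos : 0 < δ := by positivity
  have ev : ∀ᶠ m in atTop, EK k Q' L ≤ EK k Q' (P (u m)) - δ * c / 2 := by
    filter_upwards [hu.eventually_ge_atTop 0, hV.eventually_const_lt (by linarith : c < VK k Q' L)]
      with m h0 h1
    have hd := descent k Q' P hP hk h0 (by linarith : u m ≤ u m + δ)
    have : EK k Q' L ≤ EK k Q' (P (u m + δ)) := by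
      refine le_of_tendsto hE ?_
      filter_upwards [hu.eventually_ge_atTop (u m + δ)] with n hn
      exact EK_anti k Q' P hP hk (by linarith) hn
    rw [add_sub_cancel_left] at hd
    have h2 : δ * c ≤ δ * VK k Q' (P (u m)) := by gcongr
    have h3 : C * δ ^ 2 = δ * c / 2 := by rw [hδ]; field_simp
    nlinarith [sq_nonneg δ]
  have := ge_of_tendsto (hE.sub_const (δ * c / 2)) ev
  nlinarith [mul_pos hδpos hcpos]

end traj

lemma JJ_gK_prod (k : (E × E) →ᵇ ℝ) (Q : ProbabilityMeasure E) :
    JJ Q (gK k Q) = ∫ z, k z ∂((Q.prod Q : ProbabilityMeasure (E × E)) : Measure (E × E)) := by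
  rw [ProbabilityMeasure.toMeasure_prod, integral_prod _ (k.integrable _)]
  rfl

lemma tendsto_JJ {f : E →ᵇ ℝ} {Pm : ℕ → ProbabilityMeasure E} {L : ProbabilityMeasure E}
    (h : Tendsto Pm atTop (𝓝 L)) : Tendsto (fun m => JJ (Pm m) f) atTop (𝓝 (JJ L f)) :=
  ProbabilityMeasure.tendsto_iff_forall_integral_tendsto.1 h f

lemma tendsto_JJ_gK (k : (E × E) →ᵇ ℝ) {Pm : ℕ → ProbabilityMeasure E} {L : ProbabilityMeasure E}
    (h : Tendsto Pm atTop (𝓝 L)) :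
    Tendsto (fun m => JJ (Pm m) (gK k (Pm m))) atTop (𝓝 (JJ L (gK k L))) := by
  simp_rw [JJ_gK_prod]
  have := (ProbabilityMeasure.continuous_prod (α := E) (β := E)).tendsto (L, L)
  exact ProbabilityMeasure.tendsto_iff_forall_integral_tendsto.1
    (this.comp (h.prodMk_nhds h)) k

lemma tendsto_JJ_vv (k : (E × E) →ᵇ ℝ) (Q' : ProbabilityMeasure E)
    {Pm : ℕ → ProbabilityMeasure E} {L : ProbabilityMeasure E} (h : Tendsto Pm atTop (𝓝 L)) :
    Tendsto (fun m => JJ (Pm m) (vK k Q' (Pm m) * vK k Q' (Pm m))) atTop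
      (𝓝 (JJ L (vK k Q' L * vK k Q' L))) := by
  let F : (E × E) →ᵇ ℝ := (gK k Q').compContinuous ⟨Prod.fst, continuous_fst⟩ - k
  let G : (E × (E × E)) →ᵇ ℝ :=
    F.compContinuous ⟨fun p => (p.1, p.2.1), by fun_prop⟩ *
      F.compContinuous ⟨fun p => (p.1, p.2.2), by fun_prop⟩
  have key : ∀ Q : ProbabilityMeasure E, JJ Q (vK k Q' Q * vK k Q' Q) =
      ∫ z, G z ∂((Q.prod (Q.prod Q) : ProbabilityMeasure (E × (E × E))) : Measure (E × (E × E))) := by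
    intro Q
    rw [ProbabilityMeasure.toMeasure_prod, integral_prod _ (G.integrable _)]
    refine integral_congr_ae (Eventually.of_forall fun x => ?_)
    have e : ∀ y, G (x, y) = F (x, y.1) * F (x, y.2) := fun y => rfl
    simp_rw [e]
    rw [ProbabilityMeasure.toMeasure_prod,
      integral_prod_mul (fun y => F (x, y)) (fun y => F (x, y))]
    have e2 : vK k Q' Q x = ∫ y, F (x, y) ∂(Q : Measure E) := by
      change gK k Q' x - JJ Q (secK k x) = JJ Q (BoundedContinuousFunction.const E (gK k Q' x) - secK k x)
      rw [JJ_sub, JJ_const]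
    rw [← e2]; rfl
  simp_rw [key]
  have h2 := ((ProbabilityMeasure.continuous_prod (α := E) (β := E)).tendsto (L, L)).comp
    (h.prodMk_nhds h)
  have h3 := ((ProbabilityMeasure.continuous_prod (α := E) (β := E × E)).tendsto (L, L.prod L)).comp
    (h.prodMk_nhds h2)
  exact ProbabilityMeasure.tendsto_iff_forall_integral_tendsto.1 h3 G

lemma core_b (k : (E × E) →ᵇ ℝ) (hk : ∀ x y, k (x, y) = k (y, x))
    (Q' : ProbabilityMeasure E) (P : ℝ → ProbabilityMeasure E)
    (hP : ∀ (f : E →ᵇ ℝ) (t : ℝ), 0 ≤ t →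
      HasDerivWithinAt (fun s => JJ (P s) f) (JJ (P t) (f * wK k Q' (P t))) (Set.Ici 0) t)
    (L : ProbabilityMeasure E) (u : ℕ → ℝ) (hu : Tendsto u atTop atTop)
    (hL : Tendsto (fun m => P (u m)) atTop (𝓝 L)) :
    ∀ᵐ x ∂(L : Measure E), wK k Q' L x = 0 := by
  have h1 := tendsto_JJ_gK k hL
  have h2 := tendsto_JJ (f := gK k Q') hL
  have hE : Tendsto (fun m => EK k Q' (P (u m))) atTop (𝓝 (EK k Q' L)) :=
    (h1.const_mul _).sub h2
  have hV : Tendsto (fun m => VK k Q' (P (u m))) atTop (𝓝 (VK k Q' L)) := by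
    simp_rw [VK_eq']
    refine (tendsto_JJ_vv k Q' hL).sub (Tendsto.pow ?_ 2)
    simp_rw [vK, JJ_sub]
    exact h2.sub h1
  have h0 := VK_limit k Q' P hP hk L u hu hE hV
  have := (integral_eq_zero_iff_of_nonneg (fun x => mul_self_nonneg (wK k Q' L x))
    ((wK k Q' L * wK k Q' L).integrable _)).1 h0
  filter_upwards [this] with x hx
  simpa using hx

end core

lemma ispd_symm {E : Type*} [MeasurableSpace E] [MeasurableSingletonClass E] {k : E → E → ℝ}
    {K : Set E} (h : IsISPD k K) {x y : E} (hx : x ∈ K) (hy : y ∈ K) : k x y = k y x := by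
  by_contra hne
  have key : ∀ e : NNReal, ∀ f : E → ℝ,
      ∫ z, f z ∂(Measure.dirac x + e • Measure.dirac y) = f x + e * f y := by
    intro e f
    rw [integral_add_measure (integrable_dirac (by simp))
      ((integrable_dirac (by simp)).smul_measure_nnreal), integral_smul_nnreal_measure]
    simp [NNReal.smul_def]
  have key2 : ∀ e : NNReal, ∀ f : E → ℝ,
      ∫ z, f z ∂(e • Measure.dirac y) = e * f y := by
    intro e f
    rw [integral_smul_nnreal_measure]
    simp [NNReal.smul_def]
  have hdx : Measure.dirac x Kᶜ = 0 := by
    rw [Measure.dirac_apply]; simp [hx]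
  have hdy : Measure.dirac y Kᶜ = 0 := by
    rw [Measure.dirac_apply]; simp [hy]
  have h1 : ∀ e : NNReal, (Measure.dirac x + e • Measure.dirac y) Kᶜ = 0 := by
    intro e; simp [hdx, hdy]
  have h2 : ∀ e : NNReal, (e • Measure.dirac y) Kᶜ = 0 := by
    intro e; simp [hdy]
  have hneq : ∀ e : NNReal, Measure.dirac x + e • Measure.dirac y ≠ e • Measure.dirac y := by
    intro e he
    have h3 := congrArg (fun m : Measure E => ∫ _, (1 : ℝ) ∂m) he
    simp only [key e (fun _ => 1), key2 e (fun _ => 1)] at h3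
    linarith
  have hD : k x y - k y x ≠ 0 := sub_ne_zero.2 hne
  rcases le_total 0 (k x x / (k x y - k y x)) with hs | hs
  · obtain ⟨e, he⟩ : ∃ e : NNReal, (e : ℝ) = k x x / (k x y - k y x) := ⟨⟨_, hs⟩, rfl⟩
    refine hneq e (h _ _ inferInstance inferInstance (h1 e) (h2 e) ?_)
    simp only [key, key2]
    rw [eq_div_iff hD] at he
    linear_combination -he
  · obtain ⟨e, he⟩ : ∃ e : NNReal, (e : ℝ) = -(k x x / (k x y - k y x)) :=
      ⟨⟨_, by linarith⟩, rfl⟩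
    refine hneq e (h _ _ inferInstance inferInstance (h2 e) (h1 e) ?_).symm
    simp only [key, key2]
    rw [← neg_div, eq_div_iff hD] at he
    linear_combination he

lemma exists_ext_kernel {E : Type*} [MetricSpace E] {k : E → E → ℝ} {K : Set E} (hK : IsCompact K)
    (hc : ContinuousOn (fun p : E × E => k p.1 p.2) (K ×ˢ K))
    (hs : ∀ x ∈ K, ∀ y ∈ K, k x y = k y x) :
    ∃ kb : (E × E) →ᵇ ℝ, (∀ x y, kb (x, y) = kb (y, x)) ∧
      ∀ x ∈ K, ∀ y ∈ K, kb (x, y) = k x y := by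
  have hKK : IsCompact (K ×ˢ K) := hK.prod hK
  have : CompactSpace ↥(K ×ˢ K) := isCompact_iff_compactSpace.1 hKK
  let f : ↥(K ×ˢ K) →ᵇ ℝ := BoundedContinuousFunction.mkOfCompact
    ⟨fun p => k p.1.1 p.1.2, continuousOn_iff_continuous_domRestrict.1 hc⟩
  obtain ⟨g, -, hg⟩ := BoundedContinuousFunction.exists_extension_norm_eq_of_isClosedEmbedding f
    hKK.isClosed.isClosedEmbedding_subtypeVal
  have hg' : ∀ x ∈ K, ∀ y ∈ K, g (x, y) = k x y := fun x hx y hy =>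
    congrFun hg ⟨(x, y), hx, hy⟩
  refine ⟨(1 / 2 : ℝ) • (g + g.compContinuous ⟨Prod.swap, continuous_swap⟩), ?_, ?_⟩
  · intro x y
    simp [add_comm]
  · intro x hx y hy
    simp [hg' x hx y hy, hg' y hy x hx, hs y hy x hx]
    ring

section congr
variable {E : Type*} [MeasurableSpace E] {k k2 : E → E → ℝ} {K : Set E}

lemma ae_mem_of {Q : Measure E} (hQ : Q Kᶜ = 0) : ∀ᵐ x ∂Q, x ∈ K := hQ

lemma int_congr (h : ∀ x ∈ K, ∀ y ∈ K, k2 x y = k x y) {Q : Measure E} (hQ : Q Kᶜ = 0)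
    {x : E} (hx : x ∈ K) : ∫ y, k x y ∂Q = ∫ y, k2 x y ∂Q :=
  integral_congr_ae ((ae_mem_of hQ).mono fun y hy => (h x hx y hy).symm)

lemma vField_congr (h : ∀ x ∈ K, ∀ y ∈ K, k2 x y = k x y) {Q' Q : Measure E} (hQ' : Q' Kᶜ = 0)
    (hQ : Q Kᶜ = 0) {x : E} (hx : x ∈ K) : vField k Q' Q x = vField k2 Q' Q x := by
  rw [vField, vField, int_congr h hQ' hx, int_congr h hQ hx]

lemma vBar_congr (h : ∀ x ∈ K, ∀ y ∈ K, k2 x y = k x y) {Q' Q : Measure E} (hQ' : Q' Kᶜ = 0)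
    (hQ : Q Kᶜ = 0) {x : E} (hx : x ∈ K) : vBar k Q' Q x = vBar k2 Q' Q x := by
  rw [vBar, vBar, vField_congr h hQ' hQ hx]
  congr 1
  exact integral_congr_ae ((ae_mem_of hQ).mono fun y hy => vField_congr h hQ' hQ hy)

lemma intint_congr (h : ∀ x ∈ K, ∀ y ∈ K, k2 x y = k x y) {Q' Q : Measure E} (hQ' : Q' Kᶜ = 0)
    (hQ : Q Kᶜ = 0) : ∫ x, ∫ y, k x y ∂Q' ∂Q = ∫ x, ∫ y, k2 x y ∂Q' ∂Q :=
  integral_congr_ae ((ae_mem_of hQ).mono fun _ hy => int_congr h hQ' hy)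

end congr

lemma ae_msupport {E : Type*} [TopologicalSpace E] [SecondCountableTopology E] [MeasurableSpace E]
    (Q : Measure E) : ∀ᵐ x ∂Q, x ∈ msupport Q := by
  have h : Q.support ∈ ae Q := Measure.support_mem_ae
  filter_upwards [h] with x hx U hU hxU
  exact (Measure.mem_support_iff_forall x).1 hx U (hU.mem_nhds hxU)

lemma limit_supp {E : Type*} [MetricSpace E] [MeasurableSpace E] [BorelSpace E] {K : Set E}
    (hK : IsClosed K) (hne : K.Nonempty) {Pm : ℕ → Measure E} (hPm : ∀ᶠ m in atTop, Pm m Kᶜ = 0)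
    {L : Measure E} [IsProbabilityMeasure L]
    (hL : ∀ f : E →ᵇ ℝ, Tendsto (fun m => ∫ x, f x ∂(Pm m)) atTop (𝓝 (∫ x, f x ∂L))) :
    L Kᶜ = 0 := by
  let f : E →ᵇ ℝ := BoundedContinuousFunction.ofNormedAddCommGroup
    (fun x => min (Metric.infDist x K) 1) ((Metric.continuous_infDist_pt K).min continuous_const) 1
    (fun x => by
      rw [Real.norm_eq_abs, abs_of_nonneg (le_min Metric.infDist_nonneg zero_le_one)]
      exact min_le_right _ _)
  have hf : ∀ x, f x = min (Metric.infDist x K) 1 := fun x => rfl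
  have h0 : ∀ᶠ m in atTop, ∫ x, f x ∂(Pm m) = 0 := by
    filter_upwards [hPm] with m hm
    refine integral_eq_zero_of_ae ((ae_mem_of hm).mono fun x hx => ?_)
    simp [hf, Metric.infDist_zero_of_mem hx]
  have h1 : ∫ x, f x ∂L = 0 :=
    tendsto_nhds_unique (hL f) (tendsto_const_nhds.congr' (h0.mono fun m hm => hm.symm))
  have h2 := (integral_eq_zero_iff_of_nonneg
    (fun x => (le_min Metric.infDist_nonneg zero_le_one : 0 ≤ f x)) (f.integrable L)).1 h1
  have h3 : ∀ᵐ x ∂L, x ∈ K := by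
    filter_upwards [h2] with x hx
    rw [hK.mem_iff_infDist_zero hne]
    by_contra hcon
    have hp : 0 < Metric.infDist x K := lt_of_le_of_ne Metric.infDist_nonneg (Ne.symm hcon)
    have : 0 < f x := lt_min hp one_pos
    exact this.ne' hx
  exact h3

/-- **fixed points of the distribution dynamics.** Let `K ⊆ ℝ^d` be
compact, `k` a continuous integrally strictly positive definite kernel on `K`, and
`Q' ∈ P(K)`. (a) If `Q ∈ P(K)` is a fixed point (`v̄(·;Q) = 0` `Q`-a.e.) whose support
contains that of `Q'`, then `Q = Q'`; in particular the fixed-point set is contained in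
`{Q'} ∪ {Q : supp Q' ⊄ supp Q}`. (b) Every weak limit point of a trajectory of the
dynamics `dQ_t/dt = v̄(·;Q_t) Q_t` is a fixed point. -/
theorem fixed_points_of_dynamics {d : ℕ}
    (K : Set (Fin d → ℝ)) (hK : IsCompact K)
    (k : (Fin d → ℝ) → (Fin d → ℝ) → ℝ)
    (hkcont : ContinuousOn (fun p : (Fin d → ℝ) × (Fin d → ℝ) => k p.1 p.2) (K ×ˢ K))
    (hkpd : IsISPD k K)
    (Q' : Measure (Fin d → ℝ)) [IsProbabilityMeasure Q'] (hQ' : Q' Kᶜ = 0) :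
    (∀ Q : Measure (Fin d → ℝ), IsProbabilityMeasure Q → Q Kᶜ = 0 →
      (∀ᵐ x ∂Q, vBar k Q' Q x = 0) → msupport Q' ⊆ msupport Q → Q = Q') ∧
    (∀ Qt : ℝ → Measure (Fin d → ℝ),
      (∀ t : ℝ, 0 ≤ t → IsProbabilityMeasure (Qt t) ∧ Qt t Kᶜ = 0) →
      (∀ f : ContinuousMap (Fin d → ℝ) ℝ, ∀ t : ℝ, 0 ≤ t →
        HasDerivWithinAt (fun s => ∫ x, f x ∂(Qt s))
          (∫ x, f x * vBar k Q' (Qt t) x ∂(Qt t)) (Set.Ici 0) t) →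
      ∀ L : Measure (Fin d → ℝ), IsProbabilityMeasure L → IsWeakLimitPt Qt L →
        ∀ᵐ x ∂L, vBar k Q' L x = 0) := by

  have hsymm : ∀ x ∈ K, ∀ y ∈ K, k x y = k y x := fun x hx y hy => ispd_symm hkpd hx hy
  obtain ⟨kb, hkb, hkk⟩ := exists_ext_kernel hK hkcont hsymm
  let Qp : ProbabilityMeasure (Fin d → ℝ) := ⟨Q', inferInstance⟩
  refine ⟨?_, ?_⟩
  · intro Q hQ hQK hfix hsupp
    let R : ProbabilityMeasure (Fin d → ℝ) := ⟨Q, hQ⟩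
    have hw : ∀ᵐ x ∂Q, wK kb Qp R x = 0 := by
      filter_upwards [hfix, ae_mem_of hQK] with x hx hxK
      rw [wK_apply, ← hx]
      exact (vBar_congr hkk hQ' hQK hxK).symm
    have hw1 : ∀ x ∈ msupport Q, wK kb Qp R x = 0 := by
      intro x hx
      by_contra hne
      have hU : IsOpen {z | wK kb Qp R z ≠ 0} :=
        isOpen_ne_fun (wK kb Qp R).continuous continuous_const
      exact (hx _ hU hne).ne' hw
    have hw2 : JJ Qp (wK kb Qp R) = 0 :=
      integral_eq_zero_of_ae ((ae_msupport Q').mono fun x hx => hw1 x (hsupp hx))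
    rw [wK, JJ_sub, JJ_const, vK, JJ_sub, JJ_sub, JJ_gK_symm kb hkb Qp R] at hw2
    refine hkpd Q Q' inferInstance inferInstance hQK hQ' ?_
    rw [intint_congr hkk hQK hQK, intint_congr hkk hQ' hQK, intint_congr hkk hQ' hQ']
    change JJ R (gK kb R) - 2 * JJ R (gK kb Qp) + JJ Qp (gK kb Qp) = 0
    linarith
  · intro Qt hQt hdyn L hL hlim
    obtain ⟨u, hu, hconv⟩ := hlim
    have hne : K.Nonempty := by
      by_contra hcon
      rw [Set.not_nonempty_iff_eq_empty] at hcon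
      simp [hcon] at hQ'
    have hLK : L Kᶜ = 0 := by
      refine limit_supp hK.isClosed hne (Pm := fun m => Qt (u m)) ?_ hconv
      filter_upwards [hu.eventually_ge_atTop 0] with m hm
      exact (hQt _ hm).2
    let Lp : ProbabilityMeasure (Fin d → ℝ) := ⟨L, hL⟩
    let P : ℝ → ProbabilityMeasure (Fin d → ℝ) :=
      fun t => ⟨Qt (max t 0), (hQt _ (le_max_right _ _)).1⟩
    have hPt : ∀ t : ℝ, 0 ≤ t → ((P t : ProbabilityMeasure (Fin d → ℝ)) : Measure (Fin d → ℝ)) = Qt t := by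
      intro t ht
      change Qt (max t 0) = Qt t
      rw [max_eq_left ht]
    have hPdyn : ∀ (f : (Fin d → ℝ) →ᵇ ℝ) (t : ℝ), 0 ≤ t →
        HasDerivWithinAt (fun s => JJ (P s) f) (JJ (P t) (f * wK kb Qp (P t))) (Set.Ici 0) t := by
      intro f t ht
      have h := hdyn f.toContinuousMap t ht
      have e : JJ (P t) (f * wK kb Qp (P t)) = ∫ x, f x * vBar k Q' (Qt t) x ∂(Qt t) := by
        rw [JJ, hPt t ht]
        refine integral_congr_ae ((ae_mem_of (hQt t ht).2).mono fun x hx => ?_)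
        simp only [BoundedContinuousFunction.coe_mul, Pi.mul_apply]
        rw [wK_apply, hPt t ht, vBar_congr hkk hQ' (hQt t ht).2 hx]
        rfl
      rw [e]
      refine h.congr (fun s hs => ?_) ?_
      · rw [JJ, hPt s hs]; rfl
      · rw [JJ, hPt t ht]; rfl
    have hPL : Tendsto (fun m => P (u m)) atTop (𝓝 Lp) := by
      refine ProbabilityMeasure.tendsto_iff_forall_integral_tendsto.2 fun f => ?_
      refine (hconv f).congr' ?_
      filter_upwards [hu.eventually_ge_atTop 0] with m hm
      rw [hPt _ hm]
    have hfin := core_b kb hkb Qp P hPdyn Lp u hu hPL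
    have hfin' : ∀ᵐ x ∂L, wK kb Qp Lp x = 0 := hfin
    filter_upwards [hfin', ae_mem_of hLK] with x hx hxK
    rw [vBar_congr hkk hQ' hLK hxK, ← hx]
    rfl
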